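/- Let ε > 0 and φ₀ ∈ ℝ, and let φ, ψ : (0, ε) × ℝ → ℝ be differentiable functions such that the partial derivatives ∂ₓψ and ∂_θψ are uniformly bounded, such that φ(x, θ) − φ₀ = o(x) as x → 0⁺ uniformly in θ, and such that for all (x, θ) ∈ (0, ε) × ℝ one has e^{−φ(x,θ)}·x²·((1/x + ∂ₓψ(x,θ))² + (∂_θψ(x,θ))²) = e^{−φ₀}. Then ∂ₓψ(x, θ) → 0 as x → 0⁺, uniformly in θ. -/

import Mathlib

/-- Expanding the identity `e^{-p}·x²·((1/x + a)² + b²) = e^{-q}` gives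
`2xa = (e^{p-q} - 1) - x²(a² + b²)`. -/
theorem two_mul_mul_eq_of_exp_identity {p q x a b : ℝ} (hx : x ≠ 0)
    (h : Real.exp (-p) * x ^ 2 * ((1 / x + a) ^ 2 + b ^ 2) = Real.exp (-q)) :
    2 * x * a = (Real.exp (p - q) - 1) - x ^ 2 * (a ^ 2 + b ^ 2) := by
  have hp : Real.exp p * Real.exp (-p) = 1 := by rw [← Real.exp_add]; simp
  have hsq : x ^ 2 * ((1 / x + a) ^ 2 + b ^ 2) = (1 + x * a) ^ 2 + x ^ 2 * b ^ 2 := by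
    field_simp
  have key : (1 + x * a) ^ 2 + x ^ 2 * b ^ 2 = Real.exp (p - q) := by
    rw [sub_eq_add_neg, Real.exp_add, ← h, ← hsq]
    linear_combination -(x ^ 2 * ((1 / x + a) ^ 2 + b ^ 2)) * hp
  linear_combination key

/-- A pointwise bound on the radial derivative: if `|p - q| ≤ k·x ≤ 1` and `a`, `b` are bounded
by `B`, the identity `e^{-p}·x²·((1/x + a)² + b²) = e^{-q}` forces `|a| ≤ k + B²·x`. -/
theorem abs_le_of_exp_identity {p q x a b k B : ℝ} (hx : 0 < x)
    (hpq : |p - q| ≤ k * x) (hkx : k * x ≤ 1) (ha : |a| ≤ B) (hb : |b| ≤ B)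
    (h : Real.exp (-p) * x ^ 2 * ((1 / x + a) ^ 2 + b ^ 2) = Real.exp (-q)) :
    |a| ≤ k + B ^ 2 * x := by
  have hexp := abs_le.mp (Real.abs_exp_sub_one_le (hpq.trans hkx))
  have ha2 : a ^ 2 ≤ B ^ 2 := sq_le_sq' (abs_le.mp ha).1 (abs_le.mp ha).2
  have hb2 : b ^ 2 ≤ B ^ 2 := sq_le_sq' (abs_le.mp hb).1 (abs_le.mp hb).2
  have hsum : x ^ 2 * (a ^ 2 + b ^ 2) ≤ x ^ 2 * (2 * B ^ 2) := by
    gcongr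
    linarith
  have hnonneg : 0 ≤ x ^ 2 * (a ^ 2 + b ^ 2) := by positivity
  have hB : 0 ≤ x ^ 2 * B ^ 2 := by positivity
  have heq := two_mul_mul_eq_of_exp_identity hx.ne' h
  have hmul : |x * a| ≤ x * (k + B ^ 2 * x) := by
    rw [abs_le]
    constructor <;> linarith [hexp.1, hexp.2]
  rw [abs_mul, abs_of_pos hx] at hmul
  exact le_of_mul_le_mul_left hmul hx

/-- In collar coordinates of a totally geodesic funnel end, if the metric
factor `φ` satisfies `φ - φ₀ = o(x)` uniformly in `θ`, the partial derivatives `ψx, ψθ`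
of `ψ` are uniformly bounded, and the geodesic bdf identity
`e^{-φ}·x²·((1/x + ψx)² + ψθ²) = e^{-φ₀}` holds, then `ψx → 0` as `x → 0⁺`
uniformly in `θ`. -/
theorem geodesic_bdf_derivative_vanishes (ε φ₀ : ℝ) (hε : 0 < ε)
    (φ ψ ψx ψθ : ℝ → ℝ → ℝ)
    (hφdiff : ∀ x ∈ Set.Ioo (0 : ℝ) ε, ∀ θ : ℝ,
      DifferentiableAt ℝ (fun x' => φ x' θ) x ∧ DifferentiableAt ℝ (fun θ' => φ x θ') θ)
    (hψx : ∀ x ∈ Set.Ioo (0 : ℝ) ε, ∀ θ : ℝ,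
      HasDerivAt (fun x' => ψ x' θ) (ψx x θ) x)
    (hψθ : ∀ x ∈ Set.Ioo (0 : ℝ) ε, ∀ θ : ℝ,
      HasDerivAt (fun θ' => ψ x θ') (ψθ x θ) θ)
    (hbd : ∃ B : ℝ, ∀ x ∈ Set.Ioo (0 : ℝ) ε, ∀ θ : ℝ,
      |ψx x θ| ≤ B ∧ |ψθ x θ| ≤ B)
    (hφsmall : ∀ c : ℝ, 0 < c → ∃ δ : ℝ, 0 < δ ∧ δ ≤ ε ∧
      ∀ x : ℝ, 0 < x → x < δ → ∀ θ : ℝ, |φ x θ - φ₀| ≤ c * x)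
    (heq : ∀ x ∈ Set.Ioo (0 : ℝ) ε, ∀ θ : ℝ,
      Real.exp (-(φ x θ)) * x ^ 2 * ((1 / x + ψx x θ) ^ 2 + (ψθ x θ) ^ 2)
        = Real.exp (-φ₀)) :
    ∀ c : ℝ, 0 < c → ∃ δ : ℝ, 0 < δ ∧ δ ≤ ε ∧
      ∀ x : ℝ, 0 < x → x < δ → ∀ θ : ℝ, |ψx x θ| ≤ c := by
  intro c hc
  obtain ⟨B, hB⟩ := hbd
  obtain ⟨δ, hδ, hδε, hsmall⟩ := hφsmall (c / 2) (by positivity)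
  refine ⟨min δ (min (2 / c) (c / 2 / (B ^ 2 + 1))), by positivity,
    (min_le_left _ _).trans hδε, fun x hx hxδ θ => ?_⟩
  obtain ⟨hx₁, hx₂, hx₃⟩ : x < δ ∧ x < 2 / c ∧ x < c / 2 / (B ^ 2 + 1) := by
    simpa only [lt_min_iff] using hxδ
  have hmem : x ∈ Set.Ioo (0 : ℝ) ε := ⟨hx, hx₁.trans_le hδε⟩
  rw [lt_div_iff₀ hc] at hx₂
  rw [lt_div_iff₀ (by positivity)] at hx₃
  have hbound := abs_le_of_exp_identity hx (hsmall x hx hx₁ θ) (by linarith)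
    (hB x hmem θ).1 (hB x hmem θ).2 (heq x hmem θ)
  linarith
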